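/- arXiv:1904.02212 — 3 statements merged into one kernel-verified Lean document; each statement's English description precedes it below -/
import Mathlib

section
/- Fix d ≥ 3 and c ∈ (0,1), and let ε : ℕ → (0,∞) be any sequence with ε(n)·log n → ∞ as n → ∞. Let B(n) be the set of graphs in G_{d,c}(n) having more than ε(n)·n bad vertices. Then |B(n)| / |G_{d,c}(n)| → 0 as n → ∞ along integers n with n·d even. -/
open Filter

/-- The number of `k`-cliques (sets of `k` mutually adjacent vertices) in a graph. -/
noncomputable def cliqueCount {V : Type*} (G : SimpleGraph V) (k : ℕ) : ℕ :=
  Nat.card {t : Finset V // G.IsNClique k t}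

/-- A graph is `d`-regular: every vertex has degree exactly `d`. -/
def IsDRegular {V : Type*} (G : SimpleGraph V) (d : ℕ) : Prop :=
  ∀ v : V, (G.neighborSet v).ncard = d

/-- `G_{d,c}(n)`: the set of simple `d`-regular graphs on the labeled vertex set `Fin n`
with at least `c * T_max` triangles, where `T_max = (n/3) * choose d 2`. -/
noncomputable def Gdc (n d : ℕ) (c : ℝ) : Set (SimpleGraph (Fin n)) :=
  {G | IsDRegular G d ∧ c * ((n : ℝ) / 3 * (d.choose 2)) ≤ (cliqueCount G 3 : ℝ)}

/-- A vertex is bad if it is contained in a triangle but in no clique on `d+1` vertices. -/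
def BadVertex {V : Type*} (G : SimpleGraph V) (d : ℕ) (v : V) : Prop :=
  (∃ t : Finset V, G.IsNClique 3 t ∧ v ∈ t) ∧
    ¬∃ s : Finset V, G.IsNClique (d + 1) s ∧ v ∈ s

/-- The number of bad vertices of a graph. -/
noncomputable def badVertexCount {V : Type*} (G : SimpleGraph V) (d : ℕ) : ℕ :=
  Nat.card {v : V // BadVertex G d v}

open Finset Classical in
/-- The vertices whose adjacency to `v` can be described cheaply once the neighbourhoods of all
vertices preceding `v` in the order `π` are known: the earlier neighbours of `v` and the
neighbours of those. -/
noncomputable def revealed {n : ℕ} (G : SimpleGraph (Fin n)) (π : Equiv.Perm (Fin n))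
    (v : Fin n) : Finset (Fin n) :=
  univ.filter fun w =>
    (π w < π v ∧ G.Adj w v) ∨ ∃ u, π u < π v ∧ G.Adj u v ∧ G.Adj u w

open Finset Classical in
/-- The darts `(v, w)` whose head is not revealed when the neighbourhood of `v` is exposed. -/
noncomputable def costly {n : ℕ} (G : SimpleGraph (Fin n)) (π : Equiv.Perm (Fin n)) :
    Finset (Fin n × Fin n) :=
  univ.filter fun p => G.Adj p.1 p.2 ∧ p.2 ∉ revealed G π p.1

open Finset Classical in
/-- The common neighbours of two vertices. -/
noncomputable def commonNbrs {n : ℕ} (G : SimpleGraph (Fin n)) (v w : Fin n) :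
    Finset (Fin n) :=
  univ.filter fun u => G.Adj v u ∧ G.Adj w u

open Finset Classical in
/-- The set of darts of a graph, as ordered pairs. -/
noncomputable def dartPairs {n : ℕ} (G : SimpleGraph (Fin n)) : Finset (Fin n × Fin n) :=
  univ.filter fun p => G.Adj p.1 p.2

open Finset Classical in
theorem IsDRegular.card_filter_adj {n d : ℕ} {G : SimpleGraph (Fin n)} (h : IsDRegular G d)
    (v : Fin n) : (univ.filter fun w => G.Adj v w).card = d := by
  rw [← h v, ← Set.ncard_coe_finset]
  congr 1
  ext w
  simp

open Finset Classical in
theorem IsDRegular.card_revealed_le {n d : ℕ} {G : SimpleGraph (Fin n)} (h : IsDRegular G d)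
    (π : Equiv.Perm (Fin n)) (v : Fin n) : (revealed G π v).card ≤ d + d * d := by
  have hsub : revealed G π v ⊆ (univ.filter fun w => G.Adj v w) ∪
      (univ.filter fun w => G.Adj v w).biUnion fun u => univ.filter fun w => G.Adj u w := by
    intro w hw
    simp only [revealed, mem_filter, mem_univ, true_and, mem_union, mem_biUnion] at hw ⊢
    rcases hw with ⟨_, hw⟩ | ⟨u, _, huv, huw⟩
    · exact Or.inl hw.symm
    · exact Or.inr ⟨u, huv.symm, huw⟩
  refine (card_le_card hsub).trans ((card_union_le _ _).trans ?_)
  refine Nat.add_le_add (h.card_filter_adj v).le ?_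
  refine (card_biUnion_le_card_mul _ _ d fun u _ => (h.card_filter_adj u).le).trans ?_
  rw [h.card_filter_adj v]

theorem revealed_congr {n : ℕ} {G H : SimpleGraph (Fin n)} {π : Equiv.Perm (Fin n)} {v : Fin n}
    (h : ∀ u, π u < π v → ∀ w, G.Adj u w ↔ H.Adj u w) : revealed G π v = revealed H π v := by
  ext w
  simp only [revealed, Finset.mem_filter, Finset.mem_univ, true_and]
  refine or_congr (and_congr_right fun hw => h w hw v) (exists_congr fun u => ?_)
  exact and_congr_right fun hu => and_congr (h u hu v) (h u hu w)

theorem exists_injOn_fin {α : Type*} {D : ℕ} (hD : 0 < D) (A : Finset α) (hA : A.card ≤ D) :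
    ∃ f : α → Fin D, Set.InjOn f A := by
  classical
  refine ⟨fun x => if hx : x ∈ A then Fin.castLE hA (A.equivFin ⟨x, hx⟩) else ⟨0, hD⟩, ?_⟩
  intro x hx y hy hxy
  simp only [Finset.mem_coe] at hx hy
  simp only [hx, hy, dif_pos] at hxy
  simpa using hxy

theorem IsDRegular.exists_enum {n d : ℕ} {G : SimpleGraph (Fin n)} (h : IsDRegular G d)
    (v : Fin n) : ∃ e : Fin d → Fin n, Function.Injective e ∧ ∀ w, G.Adj v w ↔ ∃ i, e i = w := by
  classical
  let φ := (Finset.equivFinOfCardEq (h.card_filter_adj v)).symm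
  refine ⟨fun i => (φ i : Fin n), fun i j hij => φ.injective (Subtype.ext hij), fun w => ?_⟩
  constructor
  · intro hw
    exact ⟨φ.symm ⟨w, by simpa using hw⟩, by simp⟩
  · rintro ⟨i, rfl⟩
    exact (Finset.mem_filter.1 (φ i).2).2

open Finset in
theorem sum_inv_pow_card_costly_le {n d : ℕ} (hn : 0 < n) (hd : 0 < d)
    (S : Finset (SimpleGraph (Fin n))) (hS : ∀ G ∈ S, IsDRegular G d) (π : Equiv.Perm (Fin n)) :
    ∑ G ∈ S, ((n : ℝ)⁻¹) ^ (costly G π).card ≤ ((d + d * d + 1 : ℕ) : ℝ) ^ (n * d) := by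
  classical
  obtain ⟨D, hDdef⟩ : ∃ D, D = d + d * d := ⟨_, rfl⟩
  rw [← hDdef]
  have hD : 0 < D := by rw [hDdef]; positivity
  have henc : ∀ A : Finset (Fin n), ∃ f : Fin n → Fin D, A.card ≤ D → Set.InjOn f A := by
    intro A
    by_cases hA : A.card ≤ D
    · obtain ⟨f, hf⟩ := exists_injOn_fin hD A hA
      exact ⟨f, fun _ => hf⟩
    · exact ⟨fun _ => ⟨0, hD⟩, fun h => absurd h hA⟩
  choose enc henc using henc
  have hen : ∀ (G : SimpleGraph (Fin n)) (v : Fin n), ∃ e : Fin d → Fin n, IsDRegular G d →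
      Function.Injective e ∧ ∀ w, G.Adj v w ↔ ∃ i, e i = w := by
    intro G v
    by_cases hG : IsDRegular G d
    · obtain ⟨e, he⟩ := hG.exists_enum v
      exact ⟨e, fun _ => he⟩
    · exact ⟨fun _ => ⟨0, hn⟩, fun h => absurd h hG⟩
  choose e he using hen
  let code : SimpleGraph (Fin n) → (Fin n × Fin d → Fin D ⊕ Fin n) := fun G p =>
    if e G p.1 p.2 ∈ revealed G π p.1 then Sum.inl (enc (revealed G π p.1) (e G p.1 p.2))
    else Sum.inr (e G p.1 p.2)
  let wt : Fin D ⊕ Fin n → ℝ := Sum.elim (fun _ => 1) fun _ => (n : ℝ)⁻¹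
  have hinj : Set.InjOn code S := by
    intro G hG H hH hGH
    have hGr := hS G hG
    have hHr := hS H hH
    have key : ∀ k : ℕ, ∀ v, (π v : ℕ) = k → ∀ w, G.Adj v w ↔ H.Adj v w := by
      intro k
      induction k using Nat.strong_induction_on with
      | _ k ih =>
        intro v hv w
        have hrev : revealed G π v = revealed H π v :=
          revealed_congr fun u hu => ih (π u) (by rw [← hv]; exact hu) u rfl
        have hee : ∀ i, e G v i = e H v i := by
          intro i
          have h := congrFun hGH (v, i)
          simp only [code, ← hrev] at h
          split_ifs at h with h1 h2
          · exact henc _ (hDdef ▸ hGr.card_revealed_le π v) h1 h2 (Sum.inl_injective h)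
          · exact Sum.inr_injective h
        rw [(he G v hGr).2, (he H v hHr).2]
        simp only [hee]
    ext v w
    exact key _ v rfl w
  have hwt : ∀ G ∈ S, ((n : ℝ)⁻¹) ^ (costly G π).card = ∏ p, wt (code G p) := by
    intro G hG
    have h1 : ∀ p, wt (code G p) =
        if e G p.1 p.2 ∉ revealed G π p.1 then (n : ℝ)⁻¹ else 1 := by
      intro p
      by_cases h : e G p.1 p.2 ∈ revealed G π p.1 <;> simp [code, wt, h]
    rw [Finset.prod_congr rfl fun p _ => h1 p, Finset.prod_ite, Finset.prod_const,
      Finset.prod_const_one, mul_one]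
    congr 1
    symm
    refine Finset.card_bij (fun p _ => (p.1, e G p.1 p.2)) ?_ ?_ ?_
    · intro p hp
      simp only [mem_filter, mem_univ, true_and] at hp
      simp only [costly, mem_filter, mem_univ, true_and]
      exact ⟨((he G p.1 (hS G hG)).2 _).2 ⟨_, rfl⟩, hp⟩
    · rintro ⟨v, i⟩ _ ⟨v', i'⟩ _ h
      simp only [Prod.mk.injEq] at h
      obtain ⟨rfl, h⟩ := h
      rw [(he G v (hS G hG)).1 h]
    · rintro ⟨v, w⟩ h
      simp only [costly, mem_filter, mem_univ, true_and] at h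
      obtain ⟨i, rfl⟩ := ((he G v (hS G hG)).2 w).1 h.1
      exact ⟨(v, i), by simpa using h.2, rfl⟩
  have hwt0 : ∀ x, 0 ≤ wt x := by
    rintro (x | x)
    · exact zero_le_one
    · simp [wt]
  calc ∑ G ∈ S, ((n : ℝ)⁻¹) ^ (costly G π).card
      = ∑ G ∈ S, ∏ p, wt (code G p) := Finset.sum_congr rfl hwt
    _ = ∑ x ∈ S.image code, ∏ p, wt (x p) := by
        rw [Finset.sum_image (f := fun x : Fin n × Fin d → Fin D ⊕ Fin n => ∏ p, wt (x p)) hinj]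
    _ ≤ ∑ x : Fin n × Fin d → Fin D ⊕ Fin n, ∏ p, wt (x p) :=
        Finset.sum_le_sum_of_subset_of_nonneg (Finset.subset_univ _)
          fun x _ _ => Finset.prod_nonneg fun p _ => hwt0 _
    _ = ∏ _p : Fin n × Fin d, ∑ y, wt y := by
        rw [Finset.prod_univ_sum, Fintype.piFinset_univ]
    _ = ((D + 1 : ℕ) : ℝ) ^ (n * d) := by
        have hn' : (n : ℝ) ≠ 0 := by positivity
        simp [wt, Fintype.sum_sum_type, hn']

open Finset in
theorem card_mul_card_perm_min_le {n : ℕ} (S : Finset (Fin n)) {v : Fin n} (hv : v ∈ S) :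
    S.card * (univ.filter fun π : Equiv.Perm (Fin n) => ∀ u ∈ S, π v ≤ π u).card
      ≤ n.factorial := by
  have hcard : ∀ a ∈ S, (univ.filter fun π : Equiv.Perm (Fin n) => ∀ u ∈ S, π a ≤ π u).card =
      (univ.filter fun π : Equiv.Perm (Fin n) => ∀ u ∈ S, π v ≤ π u).card := by
    intro a ha
    have hswap : ∀ u ∈ S, Equiv.swap a v u ∈ S := by
      intro u hu
      by_cases h1 : u = a
      · simpa [h1] using hv
      · by_cases h2 : u = v
        · simpa [h2] using ha
        · rwa [Equiv.swap_apply_of_ne_of_ne h1 h2]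
    refine Finset.card_bij (fun π _ => π * Equiv.swap a v) ?_ ?_ ?_
    · intro π hπ
      simp only [mem_filter, mem_univ, true_and, Equiv.Perm.mul_apply, Equiv.swap_apply_right]
        at hπ ⊢
      exact fun u hu => hπ _ (hswap u hu)
    · intro π _ π' _ h
      exact mul_right_cancel h
    · intro π hπ
      refine ⟨π * Equiv.swap a v, ?_, by simp [mul_assoc]⟩
      simp only [mem_filter, mem_univ, true_and, Equiv.Perm.mul_apply, Equiv.swap_apply_left]
        at hπ ⊢
      exact fun u hu => hπ _ (hswap u hu)
  have hdisj : (S : Set (Fin n)).PairwiseDisjoint fun a =>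
      univ.filter fun π : Equiv.Perm (Fin n) => ∀ u ∈ S, π a ≤ π u := by
    intro a ha b hb hab
    refine Finset.disjoint_left.2 fun π h1 h2 => hab ?_
    simp only [mem_filter, mem_univ, true_and] at h1 h2
    exact π.injective (le_antisymm (h1 b hb) (h2 a ha))
  calc S.card * (univ.filter fun π : Equiv.Perm (Fin n) => ∀ u ∈ S, π v ≤ π u).card
      = ∑ a ∈ S, (univ.filter fun π : Equiv.Perm (Fin n) => ∀ u ∈ S, π a ≤ π u).card := by
        rw [Finset.sum_congr rfl hcard, Finset.sum_const, smul_eq_mul]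
    _ = (S.biUnion fun a => univ.filter fun π : Equiv.Perm (Fin n) => ∀ u ∈ S, π a ≤ π u).card :=
        (Finset.card_biUnion hdisj).symm
    _ ≤ (univ : Finset (Equiv.Perm (Fin n))).card := Finset.card_le_card (Finset.subset_univ _)
    _ = n.factorial := by rw [Finset.card_univ, Fintype.card_perm, Fintype.card_fin]

open Finset in
theorem sum_card_costly_le {n : ℕ} (G : SimpleGraph (Fin n)) :
    ∑ π : Equiv.Perm (Fin n), ((costly G π).card : ℝ) ≤
      (n.factorial : ℝ) * ∑ p ∈ dartPairs G, (((commonNbrs G p.1 p.2).card : ℝ) + 2)⁻¹ := by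
  classical
  have h1 : ∀ π : Equiv.Perm (Fin n), ((costly G π).card : ℝ) =
      ∑ p ∈ dartPairs G, if p.2 ∉ revealed G π p.1 then (1 : ℝ) else 0 := by
    intro π
    rw [Finset.sum_boole]
    congr 2
    ext p
    simp [costly, dartPairs]
  rw [Finset.sum_congr rfl fun π _ => h1 π, Finset.sum_comm, Finset.mul_sum]
  refine Finset.sum_le_sum ?_
  rintro ⟨v, w⟩ hp
  have hvw : G.Adj v w := by simpa [dartPairs] using hp
  set T := insert v (insert w (commonNbrs G v w)) with hT
  have hTc : T.card = (commonNbrs G v w).card + 2 := by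
    rw [hT, card_insert_of_notMem, card_insert_of_notMem]
    · simp [commonNbrs]
    · simp [commonNbrs, hvw.ne]
  have hle := card_mul_card_perm_min_le T (v := v) (by simp [hT])
  rw [Finset.sum_boole]
  have hsub : (univ.filter fun π : Equiv.Perm (Fin n) => w ∉ revealed G π v).card ≤
      (univ.filter fun π : Equiv.Perm (Fin n) => ∀ u ∈ T, π v ≤ π u).card := by
    refine Finset.card_le_card fun π hπ => ?_
    simp only [revealed, mem_filter, mem_univ, true_and, not_or, not_exists, not_and] at hπ ⊢
    intro u hu
    simp only [hT, mem_insert, commonNbrs, mem_filter, mem_univ, true_and] at hu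
    by_contra! hlt
    rcases hu with rfl | rfl | ⟨hvu, hwu⟩
    · exact lt_irrefl _ hlt
    · exact hπ.1 hlt hvw.symm
    · exact hπ.2 u hlt hvu.symm hwu.symm
  rw [← div_eq_mul_inv, le_div_iff₀ (by positivity), mul_comm]
  calc (((commonNbrs G v w).card : ℝ) + 2) *
        ((univ.filter fun π : Equiv.Perm (Fin n) => w ∉ revealed G π v).card : ℝ)
      ≤ (T.card : ℝ) *
        ((univ.filter fun π : Equiv.Perm (Fin n) => ∀ u ∈ T, π v ≤ π u).card : ℝ) := by
        rw [hTc]; push_cast; gcongr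
    _ ≤ n.factorial := by exact_mod_cast hle

open Finset in
theorem six_mul_cliqueCount_le {n : ℕ} (G : SimpleGraph (Fin n)) :
    6 * cliqueCount G 3 ≤ ∑ p ∈ dartPairs G, (commonNbrs G p.1 p.2).card := by
  classical
  have hcc : cliqueCount G 3 = (G.cliqueFinset 3).card := by
    rw [cliqueCount, Nat.card_eq_fintype_card, Fintype.card_subtype]
    congr 1
  rw [hcc, ← Finset.card_sigma]
  let f : (Σ _ : Fin n × Fin n, Fin n) → Finset (Fin n) := fun x => {x.1.1, x.1.2, x.2}
  refine Finset.mul_card_image_le_card_of_maps_to (f := f) ?_ 6 ?_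
  · rintro ⟨⟨a, b⟩, c⟩ hx
    simp only [dartPairs, commonNbrs, mem_sigma, mem_filter, mem_univ, true_and] at hx
    simpa [f, SimpleGraph.is3Clique_triple_iff] using hx
  · intro t ht
    obtain ⟨x, y, z, hxy, hxz, hyz, rfl⟩ :=
      SimpleGraph.is3Clique_iff.1 (SimpleGraph.mem_cliqueFinset_iff.1 ht)
    let T : Finset (Σ _ : Fin n × Fin n, Fin n) :=
      {⟨(x, y), z⟩, ⟨(x, z), y⟩, ⟨(y, x), z⟩, ⟨(y, z), x⟩, ⟨(z, x), y⟩, ⟨(z, y), x⟩}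
    have hT : T.card = 6 := by
      simp [T, Finset.card_insert_of_notMem, hxy.ne, hxz.ne, hyz.ne, hxy.ne', hxz.ne', hyz.ne']
    rw [← hT]
    refine Finset.card_le_card fun p hp => ?_
    simp only [T, mem_insert, mem_singleton] at hp
    rcases hp with rfl | rfl | rfl | rfl | rfl | rfl <;>
      simp only [dartPairs, commonNbrs, f, mem_sigma, mem_filter, mem_univ, true_and, hxy, hxz,
        hyz, hxy.symm, hxz.symm, hyz.symm, and_self] <;>
      grind

theorem commonNbrs_card_lt {n d : ℕ} {G : SimpleGraph (Fin n)} (h : IsDRegular G d)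
    {v w : Fin n} (hvw : G.Adj v w) : (commonNbrs G v w).card + 1 ≤ d := by
  classical
  have hw : w ∉ commonNbrs G v w := by simp [commonNbrs]
  rw [← Finset.card_insert_of_notMem hw]
  refine (Finset.card_le_card ?_).trans (h.card_filter_adj v).le
  intro u hu
  simp only [commonNbrs, Finset.mem_insert, Finset.mem_filter, Finset.mem_univ, true_and] at hu ⊢
  rcases hu with rfl | hu
  · exact hvw
  · exact hu.1

/-- A dart whose endpoints have the maximal number of common neighbours has endpoints with the
same closed neighbourhood. -/
theorem adj_of_commonNbrs_card_eq {n d : ℕ} {G : SimpleGraph (Fin n)} (h : IsDRegular G d)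
    {v w : Fin n} (hvw : G.Adj v w) (hc : d ≤ (commonNbrs G v w).card + 1)
    {u : Fin n} (hvu : G.Adj v u) (huw : u ≠ w) : G.Adj w u := by
  classical
  have hw : w ∉ commonNbrs G v w := by simp [commonNbrs]
  have hsub : insert w (commonNbrs G v w) ⊆ Finset.univ.filter fun w => G.Adj v w := by
    intro x hx
    simp only [commonNbrs, Finset.mem_insert, Finset.mem_filter, Finset.mem_univ, true_and]
      at hx ⊢
    rcases hx with rfl | hx
    · exact hvw
    · exact hx.1
  have heq := Finset.eq_of_subset_of_card_le hsub (by
    rw [Finset.card_insert_of_notMem hw, h.card_filter_adj v]; exact hc)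
  have hu : u ∈ insert w (commonNbrs G v w) := by rw [heq]; simpa using hvu
  simpa [commonNbrs, huw, hvu] using hu

theorem BadVertex.exists_dart {n d : ℕ} {G : SimpleGraph (Fin n)} (h : IsDRegular G d)
    {v : Fin n} (hv : BadVertex G d v) :
    ∃ w, G.Adj v w ∧ 0 < (commonNbrs G v w).card ∧ (commonNbrs G v w).card + 1 < d := by
  classical
  obtain ⟨⟨t, ht, hvt⟩, hno⟩ := hv
  by_contra! hcon
  obtain ⟨a, b, hab, hva, hvb⟩ : ∃ a b, G.Adj a b ∧ G.Adj v a ∧ G.Adj v b := by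
    obtain ⟨x, y, z, hxy, hxz, hyz, rfl⟩ := SimpleGraph.is3Clique_iff.1 ht
    simp only [Finset.mem_insert, Finset.mem_singleton] at hvt
    rcases hvt with rfl | rfl | rfl
    · exact ⟨y, z, hyz, hxy, hxz⟩
    · exact ⟨x, z, hxz, hxy.symm, hyz⟩
    · exact ⟨x, y, hxy, hxz.symm, hyz.symm⟩
  have hda : d ≤ (commonNbrs G v a).card + 1 :=
    hcon a hva (Finset.card_pos.2 ⟨b, by simp [commonNbrs, hvb, hab]⟩)
  have hall : ∀ w, G.Adj v w → d ≤ (commonNbrs G v w).card + 1 := by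
    intro w hw
    by_cases hwa : w = a
    · rwa [hwa]
    · exact hcon w hw (Finset.card_pos.2
        ⟨a, by simp [commonNbrs, hva, (adj_of_commonNbrs_card_eq h hva hda hw hwa).symm]⟩)
  refine hno ⟨insert v (Finset.univ.filter fun w => G.Adj v w), ?_, Finset.mem_insert_self _ _⟩
  refine ⟨?_, ?_⟩
  · intro x hx y hy hxy
    simp only [Finset.coe_insert, Finset.coe_filter, Finset.mem_univ, true_and,
      Set.mem_insert_iff, Set.mem_ofPred_eq] at hx hy
    rcases hx with rfl | hx <;> rcases hy with rfl | hy
    · exact absurd rfl hxy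
    · exact hy
    · exact hx.symm
    · exact adj_of_commonNbrs_card_eq h hx (hall x hx) hy hxy.symm
  · rw [Finset.card_insert_of_notMem (by simp), h.card_filter_adj v]

theorem inv_add_two_le {d k : ℕ} (hd : k + 1 ≤ d) :
    ((k : ℝ) + 2)⁻¹ ≤ 1 / 2 - k / (2 * (d + 1)) -
      (if 0 < k ∧ k + 1 < d then 1 / (6 * ((d : ℝ) + 1)) else 0) := by
  have hk0 : (0 : ℝ) ≤ k := k.cast_nonneg
  have hdk : (k : ℝ) + 1 ≤ d := by exact_mod_cast hd
  have hid : 1 / 2 - (k : ℝ) / (2 * (d + 1)) - ((k : ℝ) + 2)⁻¹ =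
      k * (d - 1 - k) / (2 * (k + 2) * (d + 1)) := by
    have : (d : ℝ) + 1 ≠ 0 := by positivity
    have : (k : ℝ) + 2 ≠ 0 := by positivity
    field_simp
    ring
  split_ifs with h
  · have h1 : (1 : ℝ) ≤ k := by exact_mod_cast h.1
    have h2 : (k : ℝ) + 2 ≤ d := by exact_mod_cast h.2
    have : 1 / (6 * ((d : ℝ) + 1)) ≤ k * (d - 1 - k) / (2 * (k + 2) * (d + 1)) := by
      rw [div_le_div_iff₀ (by positivity) (by positivity)]
      have : 2 * (k + 2) ≤ 6 * (k * ((d : ℝ) - 1 - k)) := by nlinarith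
      nlinarith
    linarith
  · have : 0 ≤ (k : ℝ) * (d - 1 - k) / (2 * (k + 2) * (d + 1)) :=
      div_nonneg (mul_nonneg hk0 (by linarith)) (by positivity)
    linarith

open Finset in
theorem sum_inv_commonNbrs_le {n d : ℕ} {G : SimpleGraph (Fin n)} (h : IsDRegular G d) :
    ∑ p ∈ dartPairs G, (((commonNbrs G p.1 p.2).card : ℝ) + 2)⁻¹ ≤
      n * d / 2 - 3 * cliqueCount G 3 / (d + 1) - badVertexCount G d / (6 * (d + 1)) := by
  classical
  have hdart : ((dartPairs G).card : ℝ) = n * d := by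
    have h2 : (dartPairs G).card = ∑ v : Fin n, ∑ w : Fin n, if G.Adj v w then 1 else 0 := by
      rw [dartPairs, Finset.card_filter, Fintype.sum_prod_type]
    rw [h2, Finset.sum_congr rfl fun v _ => by
      rw [← Finset.card_filter, h.card_filter_adj v]]
    simp
  have hbad : (badVertexCount G d : ℝ) ≤ ((dartPairs G).filter fun p =>
      0 < (commonNbrs G p.1 p.2).card ∧ (commonNbrs G p.1 p.2).card + 1 < d).card := by
    rw [badVertexCount, Nat.card_eq_fintype_card, Fintype.card_subtype, Nat.cast_le]
    refine (Finset.card_le_card ?_).trans (Finset.card_image_le (f := Prod.fst))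
    intro v hv
    obtain ⟨w, hw, hw'⟩ := BadVertex.exists_dart h (Finset.mem_filter.1 hv).2
    exact Finset.mem_image.2 ⟨(v, w), Finset.mem_filter.2 ⟨by simpa [dartPairs] using hw, hw'⟩,
      rfl⟩
  have htri : (6 : ℝ) * cliqueCount G 3 ≤ ∑ p ∈ dartPairs G, ((commonNbrs G p.1 p.2).card : ℝ) := by
    exact_mod_cast six_mul_cliqueCount_le G
  have hd1 : (0 : ℝ) < d + 1 := by positivity
  calc ∑ p ∈ dartPairs G, (((commonNbrs G p.1 p.2).card : ℝ) + 2)⁻¹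
      ≤ ∑ p ∈ dartPairs G, (1 / 2 - ((commonNbrs G p.1 p.2).card : ℝ) / (2 * (d + 1)) -
          (if 0 < (commonNbrs G p.1 p.2).card ∧ (commonNbrs G p.1 p.2).card + 1 < d
            then 1 / (6 * ((d : ℝ) + 1)) else 0)) := by
        refine Finset.sum_le_sum fun p hp => inv_add_two_le (commonNbrs_card_lt h ?_)
        simpa [dartPairs] using hp
    _ = n * d / 2 - (∑ p ∈ dartPairs G, ((commonNbrs G p.1 p.2).card : ℝ)) / (2 * (d + 1)) -
          ((dartPairs G).filter fun p => 0 < (commonNbrs G p.1 p.2).card ∧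
            (commonNbrs G p.1 p.2).card + 1 < d).card / (6 * (d + 1)) := by
        rw [Finset.sum_sub_distrib, Finset.sum_sub_distrib, Finset.sum_const, nsmul_eq_mul, hdart,
          ← Finset.sum_div, ← Finset.sum_filter, Finset.sum_const, nsmul_eq_mul]
        ring
    _ ≤ _ := by
        have h1 : 3 * (cliqueCount G 3 : ℝ) / (d + 1) ≤
            (∑ p ∈ dartPairs G, ((commonNbrs G p.1 p.2).card : ℝ)) / (2 * (d + 1)) := by
          rw [div_le_div_iff₀ hd1 (by positivity)]
          nlinarith
        gcongr

open Finset in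
/-- Entropy bound: a family of regular graphs whose expected number of costly darts in a random
order is at most `M` has at most `exp (M log n + O(n))` members. -/
theorem card_le_of_sum_inv_le {n d : ℕ} (hn : 0 < n) (hd : 0 < d)
    (S : Finset (SimpleGraph (Fin n))) (hS : ∀ G ∈ S, IsDRegular G d) (M : ℝ)
    (hM : ∀ G ∈ S, ∑ p ∈ dartPairs G, (((commonNbrs G p.1 p.2).card : ℝ) + 2)⁻¹ ≤ M) :
    (S.card : ℝ) ≤ Real.exp (M * Real.log n) * ((d + d * d + 1 : ℕ) : ℝ) ^ (n * d) := by
  classical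
  set L := Real.log n with hL
  have hL0 : 0 ≤ L := Real.log_natCast_nonneg n
  have hpow : ∀ k : ℕ, ((n : ℝ)⁻¹) ^ k = Real.exp (-(k * L)) := by
    intro k
    rw [Real.exp_neg, Real.exp_nat_mul, hL, Real.exp_log (by positivity), inv_pow]
  have hfac : (0 : ℝ) < n.factorial := by positivity
  have hjensen : ∀ G ∈ S, Real.exp (-(M * L)) ≤
      ∑ π : Equiv.Perm (Fin n), (n.factorial : ℝ)⁻¹ * ((n : ℝ)⁻¹) ^ (costly G π).card := by
    intro G hG
    have hconv := convexOn_exp.map_sum_le (t := (univ : Finset (Equiv.Perm (Fin n))))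
      (w := fun _ => (n.factorial : ℝ)⁻¹) (p := fun π => -((costly G π).card * L))
      (fun _ _ => by positivity)
      (by simp [Fintype.card_perm, hfac.ne']) (fun _ _ => Set.mem_univ _)
    simp only [smul_eq_mul] at hconv
    simp only [hpow]
    refine le_trans (Real.exp_le_exp.2 ?_) hconv
    rw [← Finset.mul_sum, Finset.sum_neg_distrib, ← Finset.sum_mul, mul_neg, neg_le_neg_iff,
      ← mul_assoc]
    refine mul_le_mul_of_nonneg_right ?_ hL0
    rw [inv_mul_le_iff₀ hfac]
    exact (sum_card_costly_le G).trans (mul_le_mul_of_nonneg_left (hM G hG) hfac.le)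
  have hsum : (S.card : ℝ) * Real.exp (-(M * L)) ≤ ((d + d * d + 1 : ℕ) : ℝ) ^ (n * d) := by
    calc (S.card : ℝ) * Real.exp (-(M * L)) = ∑ _G ∈ S, Real.exp (-(M * L)) := by simp
      _ ≤ ∑ G ∈ S, ∑ π : Equiv.Perm (Fin n),
            (n.factorial : ℝ)⁻¹ * ((n : ℝ)⁻¹) ^ (costly G π).card := Finset.sum_le_sum hjensen
      _ = (n.factorial : ℝ)⁻¹ * ∑ π : Equiv.Perm (Fin n),
            ∑ G ∈ S, ((n : ℝ)⁻¹) ^ (costly G π).card := by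
          rw [Finset.sum_comm, Finset.mul_sum]
          simp only [Finset.mul_sum]
      _ ≤ (n.factorial : ℝ)⁻¹ * ∑ _π : Equiv.Perm (Fin n),
            ((d + d * d + 1 : ℕ) : ℝ) ^ (n * d) := by
          gcongr with π
          exact sum_inv_pow_card_costly_le hn hd S hS π
      _ = _ := by
          rw [Finset.sum_const, Finset.card_univ, Fintype.card_perm, Fintype.card_fin,
            nsmul_eq_mul, inv_mul_cancel_left₀ hfac.ne']
  rw [Real.exp_neg, ← div_eq_mul_inv, div_le_iff₀ (Real.exp_pos _)] at hsum
  rw [mul_comm]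
  exact hsum

/-- The graph on `K × X` joining `(i, x)` to `(j, τ i j x)` for all `i ≠ j`. -/
def matchGraph {K X : Type*} (τ : K → K → Equiv.Perm X) (hτ : ∀ i j, τ j i = (τ i j)⁻¹) :
    SimpleGraph (K × X) where
  Adj p q := p.1 ≠ q.1 ∧ τ p.1 q.1 p.2 = q.2
  symm := ⟨by
    rintro ⟨i, x⟩ ⟨j, y⟩ ⟨hij, h⟩
    refine ⟨hij.symm, ?_⟩
    simp only at h ⊢
    rw [hτ, ← h]
    simp⟩
  loopless := ⟨fun _ h => h.1 rfl⟩

theorem matchGraph_isDRegular {X : Type*} {d : ℕ}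
    (τ : Fin (d + 1) → Fin (d + 1) → Equiv.Perm X) (hτ : ∀ i j, τ j i = (τ i j)⁻¹) :
    IsDRegular (matchGraph τ hτ) d := by
  rintro ⟨i, x⟩
  have h : (matchGraph τ hτ).neighborSet (i, x) =
      (fun j => (j, τ i j x)) '' ((Finset.univ.erase i : Finset (Fin (d + 1))) : Set _) := by
    ext ⟨j, y⟩
    simp only [SimpleGraph.mem_neighborSet, matchGraph, Set.mem_image, Finset.mem_coe,
      Finset.mem_erase, Finset.mem_univ, and_true, Prod.mk.injEq]
    constructor
    · rintro ⟨hij, h⟩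
      exact ⟨j, hij.symm, rfl, h⟩
    · rintro ⟨j', hj, rfl, h⟩
      exact ⟨hj.symm, h⟩
  rw [h, Set.ncard_image_of_injective _ fun a b hab => (Prod.mk.inj hab).1,
    Set.ncard_coe_finset, Finset.card_erase_of_mem (Finset.mem_univ _)]
  simp

theorem matchGraph_inj {K X : Type*} {τ τ' : K → K → Equiv.Perm X}
    {hτ : ∀ i j, τ j i = (τ i j)⁻¹} {hτ' : ∀ i j, τ' j i = (τ' i j)⁻¹}
    (h : matchGraph τ hτ = matchGraph τ' hτ') {i j : K} (hij : i ≠ j) : τ i j = τ' i j := by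
  ext x
  have h1 : (matchGraph τ hτ).Adj (i, x) (j, τ i j x) := ⟨hij, rfl⟩
  rw [h] at h1
  exact h1.2.symm

theorem IsDRegular.sum {V W : Type*} {G : SimpleGraph V} {H : SimpleGraph W} {d : ℕ}
    (hG : IsDRegular G d) (hH : IsDRegular H d) : IsDRegular (G ⊕g H) d := by
  rintro (v | w)
  · have h : (G ⊕g H).neighborSet (.inl v) = Sum.inl '' G.neighborSet v := by
      ext (x | x) <;> simp
    rw [h, Set.ncard_image_of_injective _ Sum.inl_injective, hG v]
  · have h : (G ⊕g H).neighborSet (.inr w) = Sum.inr '' H.neighborSet w := by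
      ext (x | x) <;> simp
    rw [h, Set.ncard_image_of_injective _ Sum.inr_injective, hH w]

theorem IsDRegular.comap_equiv {V W : Type*} {G : SimpleGraph W} {d : ℕ}
    (hG : IsDRegular G d) (e : V ≃ W) : IsDRegular (G.comap e) d := by
  intro v
  rw [← hG (e v), ← Set.ncard_image_of_injective _ e.injective]
  congr 1
  ext w
  simp only [Set.mem_image, SimpleGraph.mem_neighborSet, SimpleGraph.comap_adj]
  exact ⟨by rintro ⟨x, hx, rfl⟩; exact hx, fun hw => ⟨e.symm w, by simpa using hw, by simp⟩⟩

theorem exists_isDRegular_zmod {r d : ℕ} (hr : d < r) (he : Even (r * d)) :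
    ∃ G : SimpleGraph (ZMod r), IsDRegular G d := by
  have : NeZero r := ⟨by omega⟩
  obtain ⟨A, hA, hAs, hAc⟩ : ∃ A : Finset ℕ, (∀ a ∈ A, 0 < a ∧ a < r) ∧
      (∀ a ∈ A, r - a ∈ A) ∧ A.card = d := by
    rcases Nat.even_or_odd' d with ⟨k, rfl | rfl⟩
    · refine ⟨Finset.Icc 1 k ∪ Finset.Ico (r - k) r, ?_, ?_, ?_⟩
      · intro a; simp only [Finset.mem_union, Finset.mem_Icc, Finset.mem_Ico]; omega
      · intro a; simp only [Finset.mem_union, Finset.mem_Icc, Finset.mem_Ico]; omega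
      · rw [Finset.card_union_of_disjoint, Nat.card_Icc, Nat.card_Ico]
        · omega
        · refine Finset.disjoint_left.2 fun a => ?_
          simp only [Finset.mem_Icc, Finset.mem_Ico]; omega
    · obtain ⟨m, hm⟩ : Even r := by
        rcases Nat.even_mul.1 he with h | h
        · exact h
        · exact absurd h (by simp)
      refine ⟨insert m (Finset.Icc 1 k ∪ Finset.Ico (r - k) r), ?_, ?_, ?_⟩
      · intro a
        simp only [Finset.mem_insert, Finset.mem_union, Finset.mem_Icc, Finset.mem_Ico]; omega
      · intro a
        simp only [Finset.mem_insert, Finset.mem_union, Finset.mem_Icc, Finset.mem_Ico]; omega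
      · rw [Finset.card_insert_of_notMem, Finset.card_union_of_disjoint, Nat.card_Icc,
          Nat.card_Ico]
        · omega
        · refine Finset.disjoint_left.2 fun a => ?_
          simp only [Finset.mem_Icc, Finset.mem_Ico]; omega
        · simp only [Finset.mem_union, Finset.mem_Icc, Finset.mem_Ico]; omega
  have hneg : ∀ z : ZMod r, z.val ∈ A → (-z).val ∈ A := by
    intro z hz
    have hz0 : z ≠ 0 := by
      rintro rfl
      simpa using (hA _ hz).1
    have : NeZero z := ⟨hz0⟩
    rw [ZMod.val_neg_of_ne_zero]
    exact hAs _ hz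
  refine ⟨⟨fun x y => (y - x).val ∈ A, ⟨fun x y h => ?_⟩, ⟨fun x h => ?_⟩⟩, fun x => ?_⟩
  · simpa using hneg _ h
  · simpa using (hA _ h).1
  · rw [← hAc, ← Set.ncard_coe_finset]
    refine Set.ncard_congr (fun y _ => (y - x).val) (fun y hy => hy) ?_ ?_
    · intro a b _ _ h
      simpa using ZMod.val_injective r h
    · intro a ha
      refine ⟨x + (a : ZMod r), ?_, ?_⟩
      · change (x + (a : ZMod r) - x).val ∈ A
        rw [add_sub_cancel_left, ZMod.val_natCast_of_lt (hA a ha).2]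
        exact ha
      · rw [add_sub_cancel_left, ZMod.val_natCast_of_lt (hA a ha).2]

theorem card_mul_choose_le_cliqueCount {V X K : Type*} [Finite V] [Fintype X] [Fintype K]
    (G : SimpleGraph V) (φ : X → K → V)
    (hφ : ∀ x x' i i', φ x i = φ x' i' → x = x' ∧ i = i')
    (hadj : ∀ x i j, i ≠ j → G.Adj (φ x i) (φ x j)) :
    Fintype.card X * (Fintype.card K).choose 3 ≤ cliqueCount G 3 := by
  classical
  rw [cliqueCount, ← Fintype.card_finset_len (α := K) 3, ← Fintype.card_prod,
    ← Nat.card_eq_fintype_card]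
  let F : X × {s : Finset K // s.card = 3} → {t : Finset V // G.IsNClique 3 t} := fun p =>
    ⟨p.2.1.image (φ p.1), by
      refine ⟨?_, ?_⟩
      · intro a ha b hb hab
        simp only [Finset.coe_image, Set.mem_image] at ha hb
        obtain ⟨i, _, rfl⟩ := ha
        obtain ⟨j, _, rfl⟩ := hb
        exact hadj _ _ _ fun h => hab (by rw [h])
      · rw [Finset.card_image_of_injective _ fun i j h => (hφ _ _ _ _ h).2, p.2.2]⟩
  refine Nat.card_le_card_of_injective F ?_
  rintro ⟨x, s, hs⟩ ⟨x', s', hs'⟩ h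
  have himg : s.image (φ x) = s'.image (φ x') := congrArg Subtype.val h
  obtain ⟨i, hi⟩ : s.Nonempty := Finset.card_pos.1 (by omega)
  have hmem : φ x i ∈ s'.image (φ x') := by
    rw [← himg]; exact Finset.mem_image_of_mem _ hi
  obtain ⟨j, _, hj⟩ := Finset.mem_image.1 hmem
  obtain rfl := (hφ _ _ _ _ hj).1
  have : s = s' := Finset.image_injective (fun i j h => (hφ _ _ _ _ h).2) himg
  subst this
  rfl

/-- Transition permutations making `matchGraph` a disjoint union of cliques. -/
def cliqueTrans {d : ℕ} {X : Type*} (ρ : Fin d → Equiv.Perm X) (i j : Fin (d + 1)) :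
    Equiv.Perm X :=
  (Fin.cons (α := fun _ => Equiv.Perm X) 1 ρ j)⁻¹ * Fin.cons (α := fun _ => Equiv.Perm X) 1 ρ i

theorem cliqueTrans_symm {d : ℕ} {X : Type*} (ρ : Fin d → Equiv.Perm X) (i j : Fin (d + 1)) :
    cliqueTrans ρ j i = (cliqueTrans ρ i j)⁻¹ := by
  simp [cliqueTrans]

/-- Transition permutations obtained from an arbitrary lower triangular array. -/
def triTrans {d : ℕ} {X : Type*} (σ : (i : Fin (d + 1)) → Fin i → Equiv.Perm X)
    (i j : Fin (d + 1)) : Equiv.Perm X :=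
  if h : j < i then σ i ⟨j, h⟩ else if h : i < j then (σ j ⟨i, h⟩)⁻¹ else 1

theorem triTrans_symm {d : ℕ} {X : Type*} (σ : (i : Fin (d + 1)) → Fin i → Equiv.Perm X)
    (i j : Fin (d + 1)) : triTrans σ j i = (triTrans σ i j)⁻¹ := by
  rcases lt_trichotomy i j with h | rfl | h
  · simp [triTrans, h, h.not_gt]
  · simp [triTrans]
  · simp [triTrans, h, h.not_gt]

theorem factorial_pow_mul_le_card_Gdc {n d q b r : ℕ} {c : ℝ}
    (hn : (d + 1) * q + (d + 1) * b + r = n) (hr : d < r) (he : Even (r * d))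
    (hc : c * n ≤ (d + 1) * q) :
    q.factorial ^ d * b.factorial ^ ((d + 1) * d / 2) ≤ Nat.card (Gdc n d c) := by
  classical
  have : NeZero r := ⟨by omega⟩
  obtain ⟨R, hR⟩ := exists_isDRegular_zmod hr he
  let W := ((Fin (d + 1) × Fin q) ⊕ (Fin (d + 1) × Fin b)) ⊕ ZMod r
  have e : Fin n ≃ W := Fintype.equivOfCardEq (by simp [W, ZMod.card, ← hn])
  let P := (Fin d → Equiv.Perm (Fin q)) × ((i : Fin (d + 1)) → Fin i → Equiv.Perm (Fin b))
  let F : P → SimpleGraph W := fun p =>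
    ((matchGraph (cliqueTrans p.1) (cliqueTrans_symm p.1)) ⊕g
      (matchGraph (triTrans p.2) (triTrans_symm p.2))) ⊕g R
  have hreg : ∀ p, IsDRegular (F p) d := fun p =>
    ((matchGraph_isDRegular _ _).sum (matchGraph_isDRegular _ _)).sum hR
  have hP : Nat.card P = q.factorial ^ d * b.factorial ^ ((d + 1) * d / 2) := by
    rw [Nat.card_eq_fintype_card, Fintype.card_prod]
    congr 1
    · simp [Fintype.card_perm]
    · simp only [Fintype.card_pi, Finset.prod_const, Finset.card_univ, Fintype.card_perm,
        Fintype.card_fin]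
      rw [Finset.prod_pow_eq_pow_sum, Fin.sum_univ_eq_sum_range fun i => i,
        Finset.sum_range_id, Nat.add_sub_cancel]
  have hFinj : Function.Injective F := by
    rintro ⟨ρ, σ⟩ ⟨ρ', σ'⟩ h
    have h1 : matchGraph (cliqueTrans ρ) (cliqueTrans_symm ρ) =
        matchGraph (cliqueTrans ρ') (cliqueTrans_symm ρ') := by
      ext x y
      simpa [F] using congrArg (fun G : SimpleGraph W => G.Adj (.inl (.inl x)) (.inl (.inl y))) h
    have h2 : matchGraph (triTrans σ) (triTrans_symm σ) =
        matchGraph (triTrans σ') (triTrans_symm σ') := by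
      ext x y
      simpa [F] using congrArg (fun G : SimpleGraph W => G.Adj (.inl (.inr x)) (.inl (.inr y))) h
    congr 1
    · funext i
      have := matchGraph_inj h1 (Fin.succ_ne_zero i)
      simpa [cliqueTrans] using this
    · funext i j
      have hji : (⟨j, j.2.trans i.2⟩ : Fin (d + 1)) < i := j.2
      have := matchGraph_inj h2 hji.ne'
      simpa [triTrans, hji] using this
  rw [← hP]
  have hmem : ∀ p, (F p).comap e ∈ Gdc n d c := by
    intro p
    refine ⟨(hreg p).comap_equiv e, ?_⟩
    let ρ : Fin (d + 1) → Equiv.Perm (Fin q) := Fin.cons (α := fun _ => Equiv.Perm (Fin q)) 1 p.1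
    have hcl := card_mul_choose_le_cliqueCount ((F p).comap e)
      (fun (x : Fin q) (i : Fin (d + 1)) => e.symm (.inl (.inl (i, (ρ i)⁻¹ x))))
      (by
        intro x x' i i' h
        have h := Prod.mk.inj (Sum.inl_injective (Sum.inl_injective (e.symm.injective h)))
        obtain ⟨rfl, h⟩ := h
        exact ⟨(ρ i)⁻¹.injective h, rfl⟩)
      (by
        intro x i j hij
        simp [F, matchGraph, cliqueTrans, hij, ρ])
    rw [Fintype.card_fin, Fintype.card_fin] at hcl
    have hch : (d + 1) * d.choose 2 = (d + 1).choose 3 * 3 := Nat.add_one_mul_choose_eq d 2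
    have hch' : ((d : ℝ) + 1) * d.choose 2 = (d + 1).choose 3 * 3 := by exact_mod_cast hch
    have hcl' : (q : ℝ) * (d + 1).choose 3 ≤ cliqueCount ((F p).comap e) 3 := by
      exact_mod_cast hcl
    refine le_trans ?_ hcl'
    have := mul_le_mul_of_nonneg_right hc (Nat.cast_nonneg (α := ℝ) (d.choose 2))
    nlinarith
  refine Nat.card_le_card_of_injective (fun p => (⟨(F p).comap e, hmem p⟩ : Gdc n d c)) ?_
  intro p p' h
  refine hFinj ?_
  have h' : (F p).comap e = (F p').comap e := congrArg Subtype.val h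
  ext x y
  simpa using congrArg (fun G : SimpleGraph (Fin n) => G.Adj (e.symm x) (e.symm y)) h'

theorem mul_log_sub_le_log_factorial (m : ℕ) : m * Real.log m - m ≤ Real.log m.factorial := by
  rcases Nat.eq_zero_or_pos m with rfl | hm
  · simp
  have h := Real.pow_div_factorial_le_exp (m : ℝ) m.cast_nonneg m
  have hm' : (0 : ℝ) < m := by exact_mod_cast hm
  have hf : (0 : ℝ) < m.factorial := by positivity
  have h2 := Real.log_le_log (by positivity) h
  rw [Real.log_exp, Real.log_div (by positivity) hf.ne', Real.log_pow] at h2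
  linarith

/-- Factorials of linear size: `log m! ≥ m log n - O(n)` when `κ n ≤ m ≤ n`. -/
theorem mul_log_sub_le_log_factorial_of_le {κ : ℝ} (hκ : 0 < κ) (hκ1 : κ ≤ 1) {m n : ℕ}
    (hn : 0 < n) (hm : κ * n ≤ m) (hmn : m ≤ n) :
    m * Real.log n - (1 - Real.log κ) * n ≤ Real.log m.factorial := by
  refine le_trans ?_ (mul_log_sub_le_log_factorial m)
  have hn' : (0 : ℝ) < n := by exact_mod_cast hn
  have h1 : Real.log κ + Real.log n ≤ Real.log m := by
    rw [← Real.log_mul hκ.ne' hn'.ne']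
    exact Real.log_le_log (by positivity) hm
  have h2 : Real.log κ ≤ 0 := Real.log_nonpos hκ.le hκ1
  have h3 : (m : ℝ) ≤ n := by exact_mod_cast hmn
  nlinarith [mul_le_mul_of_nonneg_left h1 (Nat.cast_nonneg (α := ℝ) m)]

theorem exists_exp_le_card_Gdc (d : ℕ) (c : ℝ) (hc0 : 0 < c) (hc1 : c < 1) :
    ∃ C : ℝ, ∀ᶠ n : ℕ in atTop, Even (n * d) →
      Real.exp (n * (d / 2 - c * d * (d - 1) / (2 * (d + 1))) * Real.log n - C * n) ≤
        Nat.card (Gdc n d c) := by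
  have hd1 : (0 : ℝ) < d + 1 := by positivity
  set κ₁ : ℝ := c / (d + 1) with hκ₁
  set κ₂ : ℝ := (1 - c) / (2 * (d + 1)) with hκ₂
  have hκ₁0 : 0 < κ₁ := by positivity
  have hκ₂0 : 0 < κ₂ := div_pos (by linarith) (by positivity)
  have hd0 : (0 : ℝ) ≤ d := d.cast_nonneg
  have hκ₁1 : κ₁ ≤ 1 := by rw [hκ₁, div_le_one hd1]; linarith
  have hκ₂1 : κ₂ ≤ 1 := by rw [hκ₂, div_le_one (by positivity)]; linarith
  set T : ℕ := (d + 1) * d / 2 with hT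
  have hT2 : (T : ℝ) = (d + 1) * d / 2 := by
    have : 2 * T = (d + 1) * d := by
      rw [hT]
      exact Nat.mul_div_cancel' (by
        have := Nat.even_mul_succ_self d
        rw [mul_comm]
        exact this.two_dvd)
    have : (2 : ℝ) * T = (d + 1) * d := by exact_mod_cast this
    linarith
  refine ⟨d * (1 - Real.log κ₁) + T * (1 - Real.log κ₂) + 3 * T, ?_⟩
  have hlarge : ∀ᶠ n : ℕ in atTop, 6 * ((d : ℝ) + 1) / (1 - c) ≤ n :=
    tendsto_natCast_atTop_atTop.eventually_ge_atTop _
  filter_upwards [hlarge, eventually_gt_atTop 0] with n hnl hn he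
  have hn' : (0 : ℝ) < n := by exact_mod_cast hn
  rw [div_le_iff₀ (by linarith)] at hnl
  set q : ℕ := ⌈c * n / (d + 1)⌉₊ with hq
  have hq1 : c * n ≤ (d + 1) * q := by
    have := Nat.le_ceil (c * n / (d + 1))
    rw [div_le_iff₀ hd1] at this
    linarith
  have hq2 : ((d : ℝ) + 1) * q ≤ c * n + (d + 1) := by
    have := (Nat.ceil_lt_add_one (by positivity : 0 ≤ c * n / (d + 1))).le
    rw [← hq] at this
    calc ((d : ℝ) + 1) * q ≤ (d + 1) * (c * n / (d + 1) + 1) := by gcongr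
      _ = _ := by field_simp
  obtain ⟨m, hm⟩ : ∃ m, (d + 1) * q + m = n := by
    refine Nat.exists_eq_add_of_le ?_ |>.imp fun _ h => h.symm
    have : (((d + 1) * q : ℕ) : ℝ) ≤ n := by push_cast; nlinarith
    exact_mod_cast this
  have hmR : ((d : ℝ) + 1) * q + m = n := by exact_mod_cast hm
  have hmd : d + 1 ≤ m := by
    have : ((d + 1 : ℕ) : ℝ) ≤ m := by push_cast; nlinarith
    exact_mod_cast this
  obtain ⟨b, r, hbr, hr1, hr2⟩ : ∃ b r, (d + 1) * b + r = m ∧ d < r ∧ r ≤ 2 * (d + 1) := by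
    refine ⟨m / (d + 1) - 1, m % (d + 1) + (d + 1), ?_, by omega, ?_⟩
    · have h1 : 1 ≤ m / (d + 1) := (Nat.one_le_div_iff (by omega)).2 hmd
      obtain ⟨k, hk⟩ := Nat.exists_eq_add_of_le h1
      have h2 := Nat.div_add_mod m (d + 1)
      rw [hk] at h2 ⊢
      rw [Nat.add_sub_cancel_left]
      linarith
    · have := Nat.mod_lt m (show 0 < d + 1 by omega)
      omega
  have hbrR : ((d : ℝ) + 1) * b + r = m := by exact_mod_cast hbr
  have hr2R : (r : ℝ) ≤ 2 * (d + 1) := by exact_mod_cast hr2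
  have hre : Even (r * d) := by
    have h1 : n * d = (d * (d + 1)) * (q + b) + r * d := by rw [← hm, ← hbr]; ring
    rw [h1, Nat.even_add] at he
    exact he.1 ((Nat.even_mul_succ_self d).mul_right _)
  have hb : (1 - c) * n - 3 * (d + 1) ≤ (d + 1) * b := by linarith
  have hcard := factorial_pow_mul_le_card_Gdc (n := n) (q := q) (b := b) (c := c)
    (by omega) hr1 hre hq1
  have hcardR : ((q.factorial : ℝ) ^ d * (b.factorial : ℝ) ^ T) ≤ Nat.card (Gdc n d c) := by
    exact_mod_cast hcard
  refine le_trans ?_ hcardR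
  rw [← Real.le_log_iff_exp_le (by positivity), Real.log_mul (by positivity) (by positivity),
    Real.log_pow, Real.log_pow]
  have hqn : q ≤ n := by nlinarith
  have hbn : b ≤ n := by nlinarith
  have hlq := mul_log_sub_le_log_factorial_of_le hκ₁0 hκ₁1 hn (m := q) (by
    rw [hκ₁, div_mul_eq_mul_div, div_le_iff₀ hd1]; linarith) hqn
  have hlb := mul_log_sub_le_log_factorial_of_le hκ₂0 hκ₂1 hn (m := b) (by
    rw [hκ₂, div_mul_eq_mul_div, div_le_iff₀ (by positivity)]; nlinarith) hbn
  have hL0 : 0 ≤ Real.log n := Real.log_natCast_nonneg n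
  have hLn : Real.log n ≤ n := (Real.log_le_sub_one_of_pos hn').trans (by linarith)
  have hmain : n * (d / 2 - c * d * (d - 1) / (2 * (d + 1))) - 3 * T ≤
      d * (q : ℝ) + T * b := by
    have h1 : d * (c * n / (d + 1)) ≤ d * (q : ℝ) := by
      gcongr
      rw [div_le_iff₀ hd1]; linarith
    have h2 : d / 2 * ((1 - c) * n - 3 * (d + 1)) ≤ T * (b : ℝ) := by
      have := mul_le_mul_of_nonneg_left hb (by positivity : (0 : ℝ) ≤ d / 2)
      rw [hT2]
      linarith
    have h3 : (n : ℝ) * (d / 2 - c * d * (d - 1) / (2 * (d + 1))) =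
        d * (c * n / (d + 1)) + d / 2 * ((1 - c) * n) := by
      field_simp
      ring
    rw [hT2] at h2 ⊢
    rw [h3]
    linarith
  have h4 := mul_le_mul_of_nonneg_right hmain hL0
  have h5 := mul_le_mul_of_nonneg_left hlq hd0
  have h6 := mul_le_mul_of_nonneg_left hlb (Nat.cast_nonneg (α := ℝ) T)
  have h7 := mul_le_mul_of_nonneg_left hLn (by positivity : (0 : ℝ) ≤ 3 * T)
  linarith

theorem card_many_bad_le {n d : ℕ} (hn : 0 < n) (hd : 0 < d) (c η : ℝ) :
    (Nat.card {G : SimpleGraph (Fin n) | G ∈ Gdc n d c ∧ η * n < (badVertexCount G d : ℝ)} : ℝ) ≤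
      Real.exp (n * (d / 2 - c * d * (d - 1) / (2 * (d + 1)) - η / (6 * (d + 1))) * Real.log n) *
        ((d + d * d + 1 : ℕ) : ℝ) ^ (n * d) := by
  classical
  set B := {G : SimpleGraph (Fin n) | G ∈ Gdc n d c ∧ η * n < (badVertexCount G d : ℝ)} with hB
  have hBc : Nat.card B = B.toFinset.card := by
    rw [Nat.card_eq_fintype_card, Set.toFinset_card]
  rw [hBc]
  refine card_le_of_sum_inv_le hn hd _ (fun G hG => (Set.mem_toFinset.1 hG).1.1) _ fun G hG => ?_
  obtain ⟨⟨hreg, htri⟩, hbad⟩ := Set.mem_toFinset.1 hG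
  refine (sum_inv_commonNbrs_le hreg).trans ?_
  have hd1 : (0 : ℝ) < d + 1 := by positivity
  rw [Nat.cast_choose_two] at htri
  have h1 : 3 * (c * ((n : ℝ) / 3 * (d * (d - 1) / 2))) / (d + 1) ≤
      3 * cliqueCount G 3 / (d + 1) := by gcongr
  have h2 : η * n / (6 * (d + 1)) ≤ badVertexCount G d / (6 * (d + 1)) := by gcongr
  have h3 : (n : ℝ) * (d / 2 - c * d * (d - 1) / (2 * (d + 1)) - η / (6 * (d + 1))) =
      n * d / 2 - 3 * (c * ((n : ℝ) / 3 * (d * (d - 1) / 2))) / (d + 1) -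
        η * n / (6 * (d + 1)) := by
    field_simp
  rw [h3]
  linarith

/-- Structure theorem for fixed `d`, general thresholds: for any sequence `ε(n) > 0` with
`ε(n) log n → ∞`, the proportion of graphs in `G_{d,c}(n)` with more than `ε(n) * n` bad
vertices tends to `0` as `n → ∞` along `n` with `n*d` even. -/
theorem structure_fixed_d_general (d : ℕ) (hd : 3 ≤ d) (c : ℝ) (hc0 : 0 < c) (hc1 : c < 1)
    (ε : ℕ → ℝ) (hε_pos : ∀ n, 0 < ε n)
    (hε_log : Tendsto (fun n : ℕ => ε n * Real.log n) atTop atTop) :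
    Tendsto
      (fun n : ℕ =>
        (Nat.card {G : SimpleGraph (Fin n) | G ∈ Gdc n d c ∧
            ε n * n < (badVertexCount G d : ℝ)} : ℝ) /
          (Nat.card (Gdc n d c) : ℝ))
      (atTop ⊓ 𝓟 {n : ℕ | Even (n * d)}) (nhds 0) := by
  obtain ⟨C, hC⟩ := exists_exp_le_card_Gdc d c hc0 hc1
  have hd1 : (0 : ℝ) < d + 1 := by positivity
  set D : ℝ := ((d + d * d + 1 : ℕ) : ℝ) with hD
  have hD0 : 0 < D := by rw [hD]; positivity
  have hexp : Tendsto (fun n : ℕ => Real.exp (-(n : ℝ))) (atTop ⊓ 𝓟 {n : ℕ | Even (n * d)})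
      (nhds 0) :=
    (Real.tendsto_exp_neg_atTop_nhds_zero.comp tendsto_natCast_atTop_atTop).mono_left inf_le_left
  refine squeeze_zero' (Eventually.of_forall fun n => by positivity) ?_ hexp
  rw [eventually_inf_principal]
  filter_upwards [hC, eventually_gt_atTop 0,
    hε_log.eventually_ge_atTop (6 * (d + 1) * (C + d * Real.log D + 1))] with n hlow hn hεn he
  have hlow := hlow he
  have hupp := card_many_bad_le hn (by omega : 0 < d) c (ε n)
  rw [← hD] at hupp
  have hG0 : (0 : ℝ) < Nat.card (Gdc n d c) := (Real.exp_pos _).trans_le hlow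
  rw [div_le_iff₀ hG0]
  refine hupp.trans (le_trans ?_ (mul_le_mul_of_nonneg_left hlow (Real.exp_pos _).le))
  have hDp : D ^ (n * d) = Real.exp (n * d * Real.log D) := by
    rw [← Nat.cast_mul, Real.exp_nat_mul, Real.exp_log hD0]
  rw [hDp, ← Real.exp_add, ← Real.exp_add, Real.exp_le_exp]
  have hgain : C + d * Real.log D + 1 ≤ ε n * Real.log n / (6 * (d + 1)) := by
    rw [le_div_iff₀ (by positivity)]
    linarith
  have h2 := mul_le_mul_of_nonneg_left hgain (Nat.cast_nonneg (α := ℝ) n)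
  have h3 : (n : ℝ) * (ε n * Real.log n / (6 * (d + 1))) =
      n * (ε n / (6 * (d + 1))) * Real.log n := by ring
  rw [h3] at h2
  linarith
end

section
/- Let 0 < c < 1 and ε, δ > 0. Let G be a simple d-regular graph on n vertices with at least c·(n/3)·binom(d,2) triangles, and suppose at least ε·(d/2)·n edges of G are δ-bad. Then the sum over all edges e of G of t_e/(t_e + 2) is at least c·(d·n/2)·(d-1)/(d+1) + ε·δ·d²·n/(6·(d+1)). -/
/-- `t_e`: the number of triangles containing (both endpoints of) the edge `e`. -/
noncomputable def edgeTriCount {V : Type*} (G : SimpleGraph V) (e : Sym2 V) : ℕ :=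
  Nat.card {t : Finset V // G.IsNClique 3 t ∧ ∀ v ∈ e, v ∈ t}

/-- An edge `e` is `δ`-bad if `1 ≤ t_e ≤ d - 1 - δd`. -/
def DeltaBad {V : Type*} (G : SimpleGraph V) (d : ℕ) (δ : ℝ) (e : Sym2 V) : Prop :=
  1 ≤ edgeTriCount G e ∧ (edgeTriCount G e : ℝ) ≤ (d : ℝ) - 1 - δ * d

theorem edgeTriCount_eq_card_filter {V : Type*} [Fintype V] [DecidableEq V] (G : SimpleGraph V)
    [DecidableRel G.Adj] (e : Sym2 V) :
    edgeTriCount G e = ((G.cliqueFinset 3).filter fun t => ∀ v ∈ e, v ∈ t).card := by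
  classical
  rw [edgeTriCount, Nat.card_eq_fintype_card, Fintype.card_subtype]
  congr 1
  ext t
  simp [SimpleGraph.mem_cliqueFinset_iff]

theorem edgeTriCount_add_one_le {V : Type*} [Fintype V] [DecidableEq V] {G : SimpleGraph V}
    [DecidableRel G.Adj] {d : ℕ} (hreg : IsDRegular G d) {e : Sym2 V} (he : e ∈ G.edgeSet) :
    edgeTriCount G e + 1 ≤ d := by
  induction e with
  | h a b =>
  rw [SimpleGraph.mem_edgeSet] at he
  have hd : (G.neighborFinset a).card = d := by
    rw [← hreg a, ← Set.ncard_coe_finset, SimpleGraph.coe_neighborFinset]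
  have hb : b ∈ G.neighborFinset a := by simpa using he
  rw [← hd, ← Finset.card_erase_add_one hb, edgeTriCount_eq_card_filter]
  refine Nat.add_le_add_right ((Finset.card_le_card fun t ht => ?_).trans
    (Finset.card_image_le (f := fun w => ({a, b, w} : Finset V)))) 1
  simp only [Finset.mem_filter, SimpleGraph.mem_cliqueFinset_iff, Sym2.mem_iff,
    forall_eq_or_imp, forall_eq] at ht
  obtain ⟨ht, ha, hb⟩ := ht
  have hsub : ({a, b} : Finset V) ⊆ t := by
    simp [Finset.insert_subset_iff, ha, hb]
  obtain ⟨w, hw, hwt⟩ : ∃ w, w ∉ ({a, b} : Finset V) ∧ insert w {a, b} = t := by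
    rw [← Finset.covBy_iff_exists_insert, Finset.covBy_iff_card_sdiff_eq_one]
    refine ⟨hsub, ?_⟩
    rw [Finset.card_sdiff_of_subset hsub, ht.card_eq, Finset.card_pair he.ne]
  simp only [Finset.mem_insert, Finset.mem_singleton, not_or] at hw
  refine Finset.mem_image.2 ⟨w, ?_, ?_⟩
  · simp only [Finset.mem_erase, SimpleGraph.mem_neighborFinset]
    exact ⟨hw.2, ht.isClique ha (hwt ▸ Finset.mem_insert_self _ _) (Ne.symm hw.1)⟩
  · rw [← hwt]
    ext x
    simp only [Finset.mem_insert, Finset.mem_singleton]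
    tauto

theorem three_mul_card_triangles_le_sum_edgeTriCount {V : Type*} [Fintype V] [DecidableEq V]
    (G : SimpleGraph V) [DecidableRel G.Adj] :
    3 * (G.cliqueFinset 3).card ≤ ∑ e ∈ G.edgeFinset, edgeTriCount G e := by
  simp_rw [edgeTriCount_eq_card_filter]
  have h := Finset.sum_card_bipartiteAbove_eq_sum_card_bipartiteBelow (s := G.edgeFinset)
    (t := G.cliqueFinset 3) fun e t => ∀ v ∈ e, v ∈ t
  simp only [Finset.bipartiteAbove] at h
  rw [h, mul_comm, ← smul_eq_mul]
  refine Finset.card_nsmul_le_sum _ _ _ fun t ht => ?_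
  rw [SimpleGraph.mem_cliqueFinset_iff, SimpleGraph.is3Clique_iff] at ht
  obtain ⟨x, y, z, hxy, hxz, hyz, rfl⟩ := ht
  have h3 : ({s(x, y), s(x, z), s(y, z)} : Finset (Sym2 V)).card = 3 := by
    rw [Finset.card_eq_three]
    refine ⟨_, _, _, ?_, ?_, ?_, rfl⟩ <;>
      simp [hxy.ne, hxz.ne, hyz.ne, hxy.ne', hyz.ne']
  rw [← h3]
  refine Finset.card_le_card fun e he => ?_
  simp only [Finset.mem_insert, Finset.mem_singleton] at he
  rcases he with rfl | rfl | rfl <;> simp [Finset.bipartiteBelow, hxy, hxz, hyz]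

theorem div_add_one_le_div_add_two {t d : ℝ} (ht : 0 ≤ t) (htd : t + 1 ≤ d) :
    t / (d + 1) ≤ t / (t + 2) :=
  div_le_div_of_nonneg_left ht (by linarith) (by linarith)

theorem div_add_one_add_le_div_add_two {t d δ : ℝ} (hδ : 0 ≤ δ) (ht : 1 ≤ t) (hd : 0 ≤ d)
    (htd : t ≤ d - 1 - δ * d) : t / (d + 1) + δ * d / (3 * (d + 1)) ≤ t / (t + 2) := by
  have hδd : 0 ≤ δ * d := mul_nonneg hδ hd
  rw [div_add_div _ _ (by positivity) (by positivity), div_le_div_iff₀ (by positivity)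
    (by positivity)]
  have key : 0 ≤ 3 * t * (d - 1 - t) - δ * d * (t + 2) := by
    nlinarith [mul_nonneg hδd (sub_nonneg.2 ht), mul_nonneg (by linarith : (0 : ℝ) ≤ t)
      (sub_nonneg.2 htd)]
  nlinarith [mul_nonneg key (by positivity : 0 ≤ (d + 1) ^ 2)]

/-- If a `d`-regular graph on `n` vertices has at least `c * (n/3) * choose d 2` triangles,
and at least `ε (d/2) n` edges are `δ`-bad, then
`∑_e t_e/(t_e+2) ≥ c (dn/2) (d-1)/(d+1) + ε δ d² n / (6(d+1))`. -/
theorem sum_edge_triangle_ratio_bad (n d : ℕ) (c ε δ : ℝ) (hc0 : 0 < c) (hc1 : c < 1)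
    (hε : 0 < ε) (hδ : 0 < δ)
    (G : SimpleGraph (Fin n)) [DecidableRel G.Adj]
    (hreg : IsDRegular G d)
    (htri : c * ((n : ℝ) / 3 * (d.choose 2)) ≤
      (Nat.card {t : Finset (Fin n) // G.IsNClique 3 t} : ℝ))
    (hbad : ε * ((d : ℝ) / 2) * n ≤
      (Nat.card {e : Sym2 (Fin n) // e ∈ G.edgeSet ∧ DeltaBad G d δ e} : ℝ)) :
    c * ((d : ℝ) * n / 2) * (((d : ℝ) - 1) / ((d : ℝ) + 1)) +
        ε * δ * (d : ℝ) ^ 2 * n / (6 * ((d : ℝ) + 1)) ≤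
      ∑ e ∈ G.edgeFinset, (edgeTriCount G e : ℝ) / ((edgeTriCount G e : ℝ) + 2) := by
  classical
  have hd1 : (0 : ℝ) < d + 1 := by positivity
  set B := G.edgeFinset.filter (DeltaBad G d δ) with hB
  have hBcard : ε * ((d : ℝ) / 2) * n ≤ B.card := by
    rw [Nat.card_eq_fintype_card, Fintype.card_subtype] at hbad
    convert hbad using 3
    ext e
    simp [hB]
  have hT : c * ((n : ℝ) / 3 * (d.choose 2)) ≤ (G.cliqueFinset 3).card := by
    rw [Nat.card_eq_fintype_card, Fintype.card_subtype] at htri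
    convert htri using 3
    ext t
    simp [SimpleGraph.mem_cliqueFinset_iff]
  rw [Nat.cast_choose_two] at hT
  have hsum : (3 : ℝ) * (G.cliqueFinset 3).card ≤
      ∑ e ∈ G.edgeFinset, (edgeTriCount G e : ℝ) := by
    exact_mod_cast three_mul_card_triangles_le_sum_edgeTriCount G
  have hpt : ∀ e ∈ G.edgeFinset, (edgeTriCount G e : ℝ) / (d + 1) +
      (if DeltaBad G d δ e then δ * d / (3 * (d + 1)) else 0) ≤
      (edgeTriCount G e : ℝ) / ((edgeTriCount G e : ℝ) + 2) := by
    intro e he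
    split_ifs with hbe
    · exact div_add_one_add_le_div_add_two hδ.le (by exact_mod_cast hbe.1) d.cast_nonneg hbe.2
    · rw [add_zero]
      exact div_add_one_le_div_add_two (Nat.cast_nonneg _)
        (by exact_mod_cast edgeTriCount_add_one_le hreg (SimpleGraph.mem_edgeFinset.1 he))
  refine le_trans ?_ (Finset.sum_le_sum hpt)
  rw [Finset.sum_add_distrib, ← Finset.sum_div, ← Finset.sum_filter, Finset.sum_const,
    nsmul_eq_mul]
  refine add_le_add ?_ ?_
  · rw [← mul_div_assoc]
    refine div_le_div_of_nonneg_right ?_ hd1.le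
    linarith
  · calc ε * δ * (d : ℝ) ^ 2 * n / (6 * ((d : ℝ) + 1))
        = ε * ((d : ℝ) / 2) * n * (δ * d / (3 * (d + 1))) := by field_simp; ring
      _ ≤ _ := mul_le_mul_of_nonneg_right hBcard (by positivity)
end

section
/- Let G be a simple d-regular graph and δ > 0 with (1 - 16δ)·d > 1. If K₁ and K₂ are pseudo-cliques of G (with parameter δ) and K₁ ≠ K₂, then K₁ ∩ K₂ = ∅. Moreover, every dense spot of G is either disjoint from a given pseudo-clique or fully contained in it. -/
/-- A dense spot (with parameter `δ`) in a `d`-regular graph: a vertex set `H` with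
`|H| ≤ d+1` such that every `x ∈ H` has at least `(1-4δ)d` neighbors inside `H`. -/
def IsDenseSpot {V : Type*} (G : SimpleGraph V) (d : ℕ) (δ : ℝ) (H : Set V) : Prop :=
  H.ncard ≤ d + 1 ∧ ∀ x ∈ H, (1 - 4 * δ) * d ≤ ((H ∩ G.neighborSet x).ncard : ℝ)

/-- A pseudo-clique (with parameter `δ`): the union of the members of a maximal family of
pairwise-intersecting dense spots. -/
def IsPseudoClique {V : Type*} (G : SimpleGraph V) (d : ℕ) (δ : ℝ) (K : Set V) : Prop :=
  ∃ ℋ : Set (Set V),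
    (∀ H ∈ ℋ, IsDenseSpot G d δ H) ∧
    (∀ H₁ ∈ ℋ, ∀ H₂ ∈ ℋ, (H₁ ∩ H₂).Nonempty) ∧
    (∀ ℋ' : Set (Set V), ℋ ⊆ ℋ' → (∀ H ∈ ℋ', IsDenseSpot G d δ H) →
      (∀ H₁ ∈ ℋ', ∀ H₂ ∈ ℋ', (H₁ ∩ H₂).Nonempty) → ℋ' = ℋ) ∧
    K = ⋃₀ ℋ

/-- The sizes of two subsets of `C` exceed the size of `C` by at most that of their
intersection. -/
lemma Set.add_ncard_le_of_subset {V : Type*} [Finite V] {A B C : Set V} (hA : A ⊆ C)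
    (hB : B ⊆ C) : A.ncard + B.ncard ≤ C.ncard + (A ∩ B).ncard := by
  have h := Set.ncard_union_add_ncard_inter A B
  have h' := Set.ncard_le_ncard (Set.union_subset hA hB)
  omega

/-- Intersecting dense spots share most of the neighborhood of a common vertex. -/
lemma IsDenseSpot.le_ncard_inter {V : Type*} [Finite V] {G : SimpleGraph V} {d : ℕ} {δ : ℝ}
    (hreg : IsDRegular G d) {A B : Set V} (hA : IsDenseSpot G d δ A)
    (hB : IsDenseSpot G d δ B) (hAB : (A ∩ B).Nonempty) :
    (1 - 8 * δ) * d ≤ ((A ∩ B).ncard : ℝ) := by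
  obtain ⟨x, hxA, hxB⟩ := hAB
  have hsum := Set.add_ncard_le_of_subset
    (A := A ∩ G.neighborSet x) (B := B ∩ G.neighborSet x) Set.inter_subset_right
    Set.inter_subset_right
  have hsub : ((A ∩ G.neighborSet x) ∩ (B ∩ G.neighborSet x)).ncard ≤ (A ∩ B).ncard :=
    Set.ncard_le_ncard (Set.inter_subset_inter Set.inter_subset_left Set.inter_subset_left)
  rw [hreg x] at hsum
  have h : ((A ∩ G.neighborSet x).ncard : ℝ) + (B ∩ G.neighborSet x).ncard
      ≤ d + (A ∩ B).ncard := by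
    exact_mod_cast hsum.trans (Nat.add_le_add_left hsub d)
  linarith [hA.2 x hxA, hB.2 x hxB]

/-- The relation of having a common vertex is transitive on dense spots. -/
lemma IsDenseSpot.inter_nonempty_trans {V : Type*} [Finite V] {G : SimpleGraph V} {d : ℕ}
    {δ : ℝ} (hd : 1 < (1 - 16 * δ) * d) (hreg : IsDRegular G d) {A B C : Set V}
    (hA : IsDenseSpot G d δ A) (hB : IsDenseSpot G d δ B) (hC : IsDenseSpot G d δ C)
    (hAB : (A ∩ B).Nonempty) (hBC : (B ∩ C).Nonempty) : (A ∩ C).Nonempty := by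
  have hsum := Set.add_ncard_le_of_subset (A := A ∩ B) (B := B ∩ C) Set.inter_subset_right
    Set.inter_subset_left
  have h : ((A ∩ B).ncard : ℝ) + (B ∩ C).ncard ≤ (d + 1) + ((A ∩ B) ∩ (B ∩ C)).ncard := by
    exact_mod_cast hsum.trans (Nat.add_le_add_right hB.1 _)
  have hpos : (0 : ℝ) < ((A ∩ B) ∩ (B ∩ C)).ncard := by
    linarith [hA.le_ncard_inter hreg hB hAB, hB.le_ncard_inter hreg hC hBC]
  obtain ⟨x, hx, hx'⟩ := Set.nonempty_of_ncard_ne_zero (by exact_mod_cast hpos.ne')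
  exact ⟨x, hx.1, hx'.2⟩

/-- A maximal pairwise-intersecting family of dense spots contains every dense spot that
meets one of its members. -/
lemma IsDenseSpot.mem_of_maximal {V : Type*} [Finite V] {G : SimpleGraph V} {d : ℕ} {δ : ℝ}
    (hd : 1 < (1 - 16 * δ) * d) (hreg : IsDRegular G d) {ℋ : Set (Set V)}
    (hdense : ∀ H ∈ ℋ, IsDenseSpot G d δ H)
    (hinter : ∀ H₁ ∈ ℋ, ∀ H₂ ∈ ℋ, (H₁ ∩ H₂).Nonempty)
    (hmax : ∀ ℋ' : Set (Set V), ℋ ⊆ ℋ' → (∀ H ∈ ℋ', IsDenseSpot G d δ H) →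
      (∀ H₁ ∈ ℋ', ∀ H₂ ∈ ℋ', (H₁ ∩ H₂).Nonempty) → ℋ' = ℋ)
    {H A : Set V} (hH : IsDenseSpot G d δ H) (hA : A ∈ ℋ) (hHA : (H ∩ A).Nonempty) :
    H ∈ ℋ := by
  have hmeet : ∀ B ∈ ℋ, (H ∩ B).Nonempty := fun B hB =>
    hH.inter_nonempty_trans hd hreg (hdense A hA) (hdense B hB) hHA (hinter A hA B hB)
  rw [← hmax (insert H ℋ) (Set.subset_insert H ℋ)]
  · exact Set.mem_insert H ℋ
  · rintro B (rfl | hB)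
    · exact hH
    · exact hdense B hB
  · rintro B (rfl | hB) C (rfl | hC)
    · rw [Set.inter_self]
      exact hHA.mono Set.inter_subset_left
    · exact hmeet C hC
    · rw [Set.inter_comm]
      exact hmeet B hB
    · exact hinter B hB C hC

/-- Distinct pseudo-cliques are disjoint; moreover, every dense spot is either disjoint
from a given pseudo-clique or fully contained in it. -/
theorem pseudo_cliques_disjoint {V : Type*} [Fintype V] (G : SimpleGraph V) (d : ℕ)
    (δ : ℝ) (hδ : 0 < δ) (hd : 1 < (1 - 16 * δ) * d) (hreg : IsDRegular G d) :
    (∀ K₁ K₂ : Set V, IsPseudoClique G d δ K₁ → IsPseudoClique G d δ K₂ → K₁ ≠ K₂ →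
      K₁ ∩ K₂ = ∅) ∧
    (∀ (H K : Set V), IsDenseSpot G d δ H → IsPseudoClique G d δ K →
      H ∩ K = ∅ ∨ H ⊆ K) := by
  constructor
  · rintro K₁ K₂ ⟨ℋ₁, hdense₁, hinter₁, hmax₁, rfl⟩ ⟨ℋ₂, hdense₂, hinter₂, hmax₂, rfl⟩ hne
    contrapose! hne
    obtain ⟨x, ⟨H₁, hH₁, hx₁⟩, ⟨H₂, hH₂, hx₂⟩⟩ := hne
    have hH₁' : H₁ ∈ ℋ₂ :=
      (hdense₁ H₁ hH₁).mem_of_maximal hd hreg hdense₂ hinter₂ hmax₂ hH₂ ⟨x, hx₁, hx₂⟩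
    have hsub : ℋ₁ ⊆ ℋ₂ := fun H hH =>
      (hdense₁ H hH).mem_of_maximal hd hreg hdense₂ hinter₂ hmax₂ hH₁' (hinter₁ H hH H₁ hH₁)
    rw [hmax₁ ℋ₂ hsub hdense₂ hinter₂]
  · rintro H K hH ⟨ℋ, hdense, hinter, hmax, rfl⟩
    rw [or_iff_not_imp_left, ← ne_eq, ← Set.nonempty_iff_ne_empty]
    rintro ⟨x, hxH, A, hA, hxA⟩
    exact Set.subset_sUnion_of_mem
      (hH.mem_of_maximal hd hreg hdense hinter hmax hA ⟨x, hxH, hxA⟩)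
end
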